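/- Let p be a prime with p ≡ 1 (mod 3), t ≥ 1 an integer, and r = p^t. Then there exists a multiplicative character ρ of GF(r) of order 3 such that the Jacobi sum J(ρ,ρ) = Σ_{x ∈ GF(r)} ρ(x)ρ(1−x) satisfies J(ρ,ρ) = (−1)^{t+1} π^t (as complex numbers). -/

import Mathlib

/-- The Eisenstein integers `ℤ[ω]`, with `ω ^ 2 = -1 - ω`. -/
abbrev EisensteinInt : Type := QuadraticAlgebra ℤ (-1) (-1)

namespace EisensteinInt

open QuadraticAlgebra

/-- The homomorphism `ℤ[ω] → A` sending `ω` to a root `u` of `X ^ 2 + X + 1`. -/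
def evalAt {A : Type*} [CommRing A] (u : A) (hu : u ^ 2 + u + 1 = 0) : EisensteinInt →+* A :=
  (QuadraticAlgebra.lift (R := ℤ) (a := -1) (b := -1) (A := A)
    ⟨u, by simp only [neg_smul, one_smul]; linear_combination hu⟩).toRingHom

theorem evalAt_apply {A : Type*} [CommRing A] (u : A) (hu : u ^ 2 + u + 1 = 0)
    (z : EisensteinInt) : evalAt u hu z = z.re + z.im * u := by
  simp [evalAt]

theorem norm_eq (z : EisensteinInt) : z.norm = z.re ^ 2 - z.re * z.im + z.im ^ 2 := by
  rw [norm_def]; ring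

theorem norm_eq_zero_iff {z : EisensteinInt} : z.norm = 0 ↔ z = 0 := by
  refine ⟨fun h ↦ ?_, fun h ↦ by simp [h]⟩
  rw [norm_eq] at h
  have him : z.im = 0 := by
    have : z.im ^ 2 = 0 := by nlinarith [sq_nonneg (2 * z.re - z.im), sq_nonneg z.im]
    simpa using this
  have hre : z.re = 0 := by simpa [him] using h
  ext <;> simp [hre, him]

instance : IsDomain EisensteinInt :=
  have : NoZeroDivisors EisensteinInt :=
    ⟨fun {x y} h ↦ by
      rw [← norm_eq_zero_iff, ← norm_eq_zero_iff (z := y), ← mul_eq_zero, ← map_mul, h,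
        QuadraticAlgebra.norm_zero]⟩
  NoZeroDivisors.to_isDomain _

theorem omega_isPrimitiveRoot : IsPrimitiveRoot (omega : EisensteinInt) 3 := by
  refine IsPrimitiveRoot.iff_orderOf.2 (orderOf_eq_prime ?_ fun h ↦ ?_)
  · ext <;> simp [pow_succ]
  · simpa using congrArg QuadraticAlgebra.im h

theorem natCast_eq_mul_star {n : ℕ} {z : EisensteinInt} (h : z.norm = n) :
    (n : EisensteinInt) = z * star z := by
  rw [← algebraMap_norm_eq_mul_star, h]; simp

theorem evalAt_injective {A : Type*} [CommRing A] [CharZero A] (u : A) (hu : u ^ 2 + u + 1 = 0) :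
    Function.Injective (evalAt u hu) := by
  rw [injective_iff_map_eq_zero]
  intro z hz
  have h : evalAt u hu (z.norm : EisensteinInt) = 0 := by
    rw [← eq_intCast (algebraMap ℤ EisensteinInt), algebraMap_norm_eq_mul_star, map_mul, hz,
      zero_mul]
  rwa [map_intCast, Int.cast_eq_zero, norm_eq_zero_iff] at h

/-- A unit congruent to a sign modulo `3` is that sign. -/
theorem eq_of_norm_eq_one_of_three_dvd_sub {u : EisensteinInt} {s : ℤ} (hs : s = 1 ∨ s = -1)
    (hu : u.norm = 1) (h : (3 : EisensteinInt) ∣ u - s) : u = s := by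
  obtain ⟨z, hz⟩ := h
  have hre : u.re - s = 3 * z.re := by simpa using congrArg QuadraticAlgebra.re hz
  have him : u.im = 3 * z.im := by simpa using congrArg QuadraticAlgebra.im hz
  rw [norm_eq] at hu
  have h1 : u.im = 0 := by
    have : -2 < u.im := by nlinarith [sq_nonneg (2 * u.re - u.im)]
    have : u.im < 2 := by nlinarith [sq_nonneg (2 * u.re - u.im)]
    lia
  rw [h1] at hu
  have h2 : u.re = 1 ∨ u.re = -1 := by
    have : (u.re - 1) * (u.re + 1) = 0 := by linear_combination hu
    rcases mul_eq_zero.1 this with h | h <;> lia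
  ext
  · simp only [re_intCast, Int.cast_id]; lia
  · simpa using h1

/-- The kernel of a reduction map `ℤ[ω] → F` that kills the conjugate of an element `w` of
norm `p = char F` is generated by this conjugate. -/
theorem star_dvd_of_evalAt_eq_zero {F : Type*} [Field F] {p : ℕ} [CharP F p] {g : F}
    (hg : g ^ 2 + g + 1 = 0) {w : EisensteinInt} (hw : w.norm = p)
    (hgw : evalAt g hg (star w) = 0) (hw0 : w ≠ 0) {y : EisensteinInt}
    (hy : evalAt g hg y = 0) :
    star w ∣ y := by
  rw [evalAt_apply] at hy hgw
  simp only [re_star, im_star] at hgw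
  push_cast at hgw
  have hre : (p : ℤ) ∣ (y * w).re := by
    rw [← CharP.intCast_eq_zero_iff F p]
    simp only [re_mul]; push_cast
    linear_combination w.re * hy - y.im * g * hgw - y.im * w.im * hg
  have him : (p : ℤ) ∣ (y * w).im := by
    rw [← CharP.intCast_eq_zero_iff F p]
    simp only [im_mul]; push_cast
    linear_combination w.im * hy + y.im * hgw
  obtain ⟨c, hc⟩ := hre
  obtain ⟨d, hd⟩ := him
  refine ⟨⟨c, d⟩, mul_right_cancel₀ hw0 ?_⟩
  have : y * w = (p : EisensteinInt) * ⟨c, d⟩ := by ext <;> simp [hc, hd]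
  rw [this, natCast_eq_mul_star hw]; ring

theorem exists_eq_mul_pow_of_norm_eq_pow {F : Type*} [Field F] {p : ℕ} [CharP F p] {g : F}
    (hg : g ^ 2 + g + 1 = 0) {w : EisensteinInt} (hw : w.norm = p)
    (hgw : evalAt g hg (star w) = 0) (hw0 : w ≠ 0) (t : ℕ) (x : EisensteinInt)
    (hx : x.norm = (p : ℤ) ^ t) (hgx : evalAt g hg x ≠ 0) :
    ∃ u : EisensteinInt, u.norm = 1 ∧ x = u * w ^ t := by
  induction t generalizing x with
  | zero => exact ⟨x, by simpa using hx, by simp⟩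
  | succ t ih =>
    have hx' : evalAt g hg x * evalAt g hg (star x) = 0 := by
      rw [← map_mul, ← natCast_eq_mul_star (n := p ^ (t + 1)) (by simpa using hx)]
      simp
    obtain ⟨z, hz⟩ := star_dvd_of_evalAt_eq_zero hg hw hgw hw0
      ((mul_eq_zero.1 hx').resolve_left hgx)
    have hz : x = w * star z := by
      rw [← star_star x, hz, star_mul', star_star]
    have hp : (p : ℤ) ≠ 0 := by rwa [← hw, Ne, norm_eq_zero_iff]
    obtain ⟨u, hu, h⟩ := ih (star z)
      (mul_left_cancel₀ hp (by rw [← pow_succ', ← hx, hz, map_mul, hw]))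
      (fun h ↦ hgx (by rw [hz, map_mul, h, mul_zero]))
    exact ⟨u, hu, by rw [hz, h]; ring⟩

/-- An element congruent to `-1` modulo `3` of norm `p ^ t`, coprime to the conjugate of `w`,
is `w ^ t` up to an explicit sign. -/
theorem eq_neg_one_pow_mul_pow {F : Type*} [Field F] {p : ℕ} [CharP F p] {g : F}
    (hg : g ^ 2 + g + 1 = 0) {w : EisensteinInt} (hw : w.norm = p)
    (hgw : evalAt g hg (star w) = 0) (hw0 : w ≠ 0) (hw3 : (3 : EisensteinInt) ∣ w + 1)
    (t : ℕ) (x : EisensteinInt) (hx : x.norm = (p : ℤ) ^ t) (hgx : evalAt g hg x ≠ 0)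
    (hx3 : (3 : EisensteinInt) ∣ x + 1) : x = (-1) ^ (t + 1) * w ^ t := by
  obtain ⟨u, hu, rfl⟩ := exists_eq_mul_pow_of_norm_eq_pow hg hw hgw hw0 t x hx hgx
  have h1 : (3 : EisensteinInt) ∣ w ^ t - (-1) ^ t :=
    (by simpa using hw3 : (3 : EisensteinInt) ∣ w - (-1)).trans (sub_dvd_pow_sub_pow _ _ _)
  have h2 : (3 : EisensteinInt) ∣ u - ((-1) ^ (t + 1) : ℤ) := by
    have h3 := ((hx3.sub (h1.mul_left u)).mul_left ((-1) ^ t))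
    convert h3 using 1
    have h4 : ((-1) ^ t * (-1) ^ t : EisensteinInt) = 1 := by rw [← mul_pow]; simp
    push_cast
    linear_combination -u * h4
  rw [eq_of_norm_eq_one_of_three_dvd_sub (neg_one_pow_eq_or ℤ _) hu h2]
  push_cast; rfl

end EisensteinInt

/-- `p` does not divide the central binomial coefficient of `(p ^ t - 1) / 3`, whose base `p`
digits are all `(p - 1) / 3`. -/
theorem not_dvd_choose_two_mul_of_three_mul_add_one {p : ℕ} (hp : p.Prime) (hp3 : p % 3 = 1)
    (t m : ℕ) (hm : 3 * m + 1 = p ^ t) : ¬ p ∣ (2 * m).choose m := by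
  have : Fact p.Prime := ⟨hp⟩
  induction t generalizing m with
  | zero =>
    obtain rfl : m = 0 := by simpa using hm
    simpa using hp.one_lt.ne'
  | succ t ih =>
    obtain ⟨k, hk⟩ : ∃ k, p = 3 * k + 1 := ⟨p / 3, by lia⟩
    obtain ⟨n, hn⟩ : ∃ n, p ^ t = 3 * n + 1 := ⟨p ^ t / 3, by
      have : p ^ t % 3 = 1 := by simp [Nat.pow_mod, hp3]
      lia⟩
    have hmn : m = k + p * n := by
      have : 3 * m + 1 = 3 * (k + p * n) + 1 := by
        rw [hm, pow_succ, hn]; nlinarith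
      lia
    have h2 : 2 * m = 2 * k + p * (2 * n) := by rw [hmn]; ring
    have hlucas := Choose.choose_modEq_choose_mod_mul_choose_div_nat (n := 2 * m) (k := m) (p := p)
    have e1 : m % p = k := by rw [hmn, Nat.add_mul_mod_self_left, Nat.mod_eq_of_lt (by lia)]
    have e2 : 2 * m % p = 2 * k := by
      rw [h2, Nat.add_mul_mod_self_left, Nat.mod_eq_of_lt (by lia)]
    have e3 : m / p = n := by
      rw [hmn, Nat.add_mul_div_left _ _ hp.pos, Nat.div_eq_of_lt (by lia), zero_add]
    have e4 : 2 * m / p = 2 * n := by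
      rw [h2, Nat.add_mul_div_left _ _ hp.pos, Nat.div_eq_of_lt (by lia), zero_add]
    rw [e1, e2, e3, e4] at hlucas
    rw [hlucas.dvd_iff dvd_rfl, hp.dvd_mul, not_or]
    refine ⟨fun h ↦ ?_, ih n hn.symm⟩
    have hdvd : (2 * k).choose k ∣ (2 * k).factorial := by
      rw [← Nat.choose_mul_factorial_mul_factorial (by lia : k ≤ 2 * k), mul_assoc]
      exact dvd_mul_right _ _
    have := hp.dvd_factorial.1 (h.trans hdvd)
    lia

theorem FiniteField.sum_pow_eq_ite {F : Type*} [Field F] [Fintype F] {i : ℕ} (hi : i ≠ 0) :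
    ∑ x : F, x ^ i = if Fintype.card F - 1 ∣ i then -1 else 0 := by
  classical
  rw [← FiniteField.sum_pow_units, ← Finset.sum_subset (Finset.subset_univ
    (Finset.univ.image (Units.val : Fˣ → F))), Finset.sum_image Units.val_injective.injOn]
  intro x _ hx
  have : x = 0 := by
    by_contra h
    exact hx (Finset.mem_image.2 ⟨Units.mk0 x h, Finset.mem_univ _, rfl⟩)
  simp [this, hi]

theorem FiniteField.sum_pow_mul_one_sub_pow {F : Type*} [Field F] [Fintype F] {m : ℕ} (hm : 0 < m)
    (hF : Fintype.card F = 3 * m + 1) :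
    ∑ x : F, x ^ (2 * m) * (1 - x) ^ (2 * m) = -((-1) ^ m * ((2 * m).choose m : F)) := by
  have h (x : F) : x ^ (2 * m) * (1 - x) ^ (2 * m) =
      ∑ j ∈ Finset.range (2 * m + 1), (-1) ^ j * ((2 * m).choose j : F) * x ^ (2 * m + j) := by
    rw [sub_eq_neg_add, add_pow, Finset.mul_sum]
    refine Finset.sum_congr rfl fun j _ ↦ ?_
    rw [neg_pow, pow_add]; ring
  simp_rw [h]
  rw [Finset.sum_comm, Finset.sum_eq_single m]
  · rw [← Finset.mul_sum, FiniteField.sum_pow_eq_ite (by lia), if_pos, mul_neg_one]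
    rw [hF]; exact ⟨1, by lia⟩
  · intro j hj hjm
    rw [← Finset.mul_sum, FiniteField.sum_pow_eq_ite (by lia), if_neg, mul_zero]
    rw [hF, Nat.add_sub_cancel]
    rintro ⟨c, hc⟩
    have := Finset.mem_range.1 hj
    rcases lt_trichotomy c 1 with h | h | h
    · obtain rfl : c = 0 := by lia
      lia
    · subst h; lia
    · nlinarith
  · intro h; exact absurd (Finset.mem_range.2 (by lia)) h

/-- If `3 * m + 1 = #F`, some `ℤ[ω]`-valued cubic character of `F` reduces to `x ↦ x ^ (2 * m)`
under `ω ↦ g`. -/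
theorem EisensteinInt.exists_mulChar_evalAt_eq_pow {F : Type*} [Field F] [Fintype F] {m : ℕ}
    (hm : 0 < m) (hF : Fintype.card F = 3 * m + 1) {g : F} (hg : g ^ 2 + g + 1 = 0) :
    ∃ χ : MulChar F EisensteinInt, χ ^ 3 = 1 ∧ χ ≠ 1 ∧
      ∀ x, evalAt g hg (χ x) = x ^ (2 * m) := by
  classical
  obtain ⟨χ, hχ⟩ := MulChar.exists_mulChar_orderOf F (n := 3) (by rw [hF]; exact ⟨m, by lia⟩)
    omega_isPrimitiveRoot
  have hχ3 : χ ^ 3 = 1 := hχ ▸ pow_orderOf_eq_one χ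
  have hχ1 : χ ≠ 1 := by rintro rfl; simp at hχ
  obtain ⟨c, hc⟩ := IsCyclic.exists_generator (α := Fˣ)
  have hcard : orderOf c = 3 * m := by
    rw [orderOf_eq_card_of_forall_mem_zpowers hc, Nat.card_eq_fintype_card, Fintype.card_units, hF,
      Nat.add_sub_cancel]
  have hg3 : g ^ 3 = 1 := by linear_combination (g - 1) * hg
  have hz1 : (c : F) ^ (2 * m) ≠ 1 := by
    intro h
    have : c ^ (2 * m) = 1 := by ext; simpa using h
    have := Nat.le_of_dvd (by lia) (hcard ▸ orderOf_dvd_of_pow_eq_one this)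
    lia
  have hz3 : ((c : F) ^ (2 * m)) ^ 3 = 1 := by
    have h : c ^ (3 * m) = 1 := hcard ▸ pow_orderOf_eq_one c
    have h' : (c : F) ^ (3 * m) = 1 := by simpa using congrArg Units.val h
    rw [← pow_mul, show 2 * m * 3 = 3 * m * 2 by ring, pow_mul, h', one_pow]
  have hz : (c : F) ^ (2 * m) = g ∨ (c : F) ^ (2 * m) = g ^ 2 := by
    generalize (c : F) ^ (2 * m) = z at hz1 hz3
    have h : z - 1 ≠ 0 := sub_ne_zero.2 hz1
    have h2 : (z - 1) * ((z - g) * (z - g ^ 2)) = 0 := by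
      linear_combination hz3 + (-z ^ 2 + z * g) * hg + (z - 1) * hg3 - g * z * hg + z * hg
    rcases mul_eq_zero.1 ((mul_eq_zero.1 h2).resolve_left h) with h | h
    · exact .inl (sub_eq_zero.1 h)
    · exact .inr (sub_eq_zero.1 h)
  have key (ψ : MulChar F EisensteinInt) (h : evalAt g hg (ψ c) = (c : F) ^ (2 * m)) (x : F) :
      evalAt g hg (ψ x) = x ^ (2 * m) := by
    have h2 : ψ.ringHomComp (evalAt g hg) = MulChar.ofUnitHom (powMonoidHom (2 * m)) := by
      rw [MulChar.eq_iff hc]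
      simpa using h
    rcases eq_or_ne x 0 with rfl | hx
    · rw [MulChar.map_zero, map_zero, zero_pow (by lia)]
    · lift x to Fˣ using hx.isUnit
      simpa only [MulChar.ringHomComp_apply, MulChar.ofUnitHom_coe, powMonoidHom_apply,
        Units.val_pow_eq_pow_val] using DFunLike.congr_fun h2 (x : F)
  have hom : evalAt g hg QuadraticAlgebra.omega = g := by simp [evalAt_apply]
  obtain ⟨k, hk, hck⟩ := MulChar.exists_apply_eq_pow hχ3 omega_isPrimitiveRoot c.ne_zero
  have hk0 : k ≠ 0 := by
    rintro rfl
    exact hχ1 ((MulChar.eq_iff hc _ _).2 (by simp [hck]))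
  have hχ21 : χ ^ 2 ≠ 1 := fun h ↦ hχ1 (by rw [← hχ3, pow_succ, h, one_mul])
  have hχ23 : (χ ^ 2) ^ 3 = 1 := by rw [← pow_mul, mul_comm, pow_mul, hχ3, one_pow]
  have hg4 : (g ^ 2) ^ 2 = g := by linear_combination g * hg3
  have hsq : (χ ^ 2) c = χ c ^ 2 := MulChar.pow_apply_coe _ _ _
  obtain rfl | rfl : k = 1 ∨ k = 2 := by lia
  · rcases hz with hz | hz
    · exact ⟨χ, hχ3, hχ1, key _ (by simp [hck, hom, hz])⟩
    · exact ⟨χ ^ 2, hχ23, hχ21, key _ (by simp [hsq, hck, hom, hz])⟩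
  · rcases hz with hz | hz
    · exact ⟨χ ^ 2, hχ23, hχ21, key _ (by simp [hsq, hck, hom, hz, hg4])⟩
    · exact ⟨χ, hχ3, hχ1, key _ (by simp [hck, hom, hz])⟩

theorem FiniteField.exists_sq_add_self_add_one_eq_zero {F : Type*} [Field F] [Fintype F]
    (h : 3 ∣ Fintype.card F - 1) : ∃ g : F, g ^ 2 + g + 1 = 0 := by
  classical
  have : Fact (Nat.Prime 3) := ⟨Nat.prime_three⟩
  obtain ⟨u, hu⟩ := exists_prime_orderOf_dvd_card (G := Fˣ) 3 (by rwa [Fintype.card_units])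
  have h3 : (u : F) ^ 3 = 1 := by
    rw [← Units.val_pow_eq_pow_val, ← hu, pow_orderOf_eq_one, Units.val_one]
  have h1 : (u : F) - 1 ≠ 0 := by
    rw [sub_ne_zero]
    intro h
    have : u = 1 := by ext; simpa using h
    simp [this] at hu
  exact ⟨u, (mul_eq_zero.1 (by linear_combination h3 :
    ((u : F) - 1) * ((u : F) ^ 2 + u + 1) = 0)).resolve_left h1⟩

namespace EisensteinInt

theorem norm_jacobiSum {F : Type*} [Field F] [Fintype F] {χ : MulChar F EisensteinInt}
    (hχ3 : χ ^ 3 = 1) (hχ1 : χ ≠ 1) : (jacobiSum χ χ).norm = Fintype.card F := by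
  have hstar : χ.ringHomComp (starRingEnd EisensteinInt) = χ⁻¹ := by
    rw [eq_comm, inv_eq_iff_mul_eq_one]
    refine MulChar.ext fun a ↦ ?_
    obtain ⟨k, -, hk⟩ := MulChar.exists_apply_eq_pow hχ3 omega_isPrimitiveRoot a.ne_zero
    have h : QuadraticAlgebra.omega * star QuadraticAlgebra.omega = (1 : EisensteinInt) := by
      ext <;> simp [QuadraticAlgebra.re_one, QuadraticAlgebra.im_one]
    simp [hk, starRingEnd_apply, ← mul_pow, h]
  have hinj := IsFractionRing.injective EisensteinInt (FractionRing EisensteinInt)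
  have : CharZero (FractionRing EisensteinInt) := charZero_of_injective_algebraMap hinj
  set f := algebraMap EisensteinInt (FractionRing EisensteinInt)
  have hne : χ.ringHomComp f ≠ 1 := (MulChar.ringHomComp_ne_one_iff hinj).2 hχ1
  have hne2 : χ.ringHomComp f * χ.ringHomComp f ≠ 1 := by
    rw [← MulChar.ringHomComp_mul, MulChar.ringHomComp_ne_one_iff hinj]
    intro h
    exact hχ1 (by rw [← hχ3, pow_succ, pow_two, h, one_mul])
  have hchar : ringChar (FractionRing EisensteinInt) ≠ ringChar F := by
    rw [ringChar.eq_zero]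
    exact (CharP.ringChar_ne_zero_of_finite F).symm
  have hJ := jacobiSum_mul_jacobiSum_inv hchar hne hne hne2
  rw [MulChar.ringHomComp_inv, jacobiSum_ringHomComp, jacobiSum_ringHomComp, ← hstar,
    jacobiSum_ringHomComp, ← map_mul, ← map_natCast f] at hJ
  have := hinj hJ
  rw [starRingEnd_apply, ← QuadraticAlgebra.algebraMap_norm_eq_mul_star] at this
  simpa using congrArg QuadraticAlgebra.re this

theorem three_dvd_jacobiSum_add_one {F : Type*} [Field F] [Fintype F]
    (h : 3 ∣ Fintype.card F - 1) {χ : MulChar F EisensteinInt} (hχ3 : χ ^ 3 = 1) :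
    (3 : EisensteinInt) ∣ jacobiSum χ χ + 1 := by
  obtain ⟨z, -, hz⟩ := exists_jacobiSum_eq_neg_one_add (by norm_num) hχ3 hχ3 h
    omega_isPrimitiveRoot
  refine ⟨-QuadraticAlgebra.omega * z, ?_⟩
  have h3 : (QuadraticAlgebra.omega - 1 : EisensteinInt) ^ 2 = -3 * QuadraticAlgebra.omega := by
    ext <;> simp [pow_two, QuadraticAlgebra.re_one, QuadraticAlgebra.im_one,
      QuadraticAlgebra.re_ofNat, QuadraticAlgebra.im_ofNat]
  rw [hz, h3]; ring

end EisensteinInt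

/-- For `p ≡ 1 (mod 3)`, `r = p^t`, there is a cubic character `ρ` of `GF(r)`
with `J(ρ,ρ) = (−1)^{t+1} π^t`, where `π = a₀ + b₀ω`, `p = a₀² − a₀b₀ + b₀²`,
`a₀ ≡ 2 (mod 3)`, `b₀ ≡ 0 (mod 3)`, `b₀ > 0`. -/
theorem stmt_9 (p t : ℕ) (hp : p.Prime) (hp3 : p % 3 = 1) (ht : 1 ≤ t)
    (F : Type) [Field F] [Fintype F] (hcardF : Fintype.card F = p ^ t)
    (a₀ b₀ : ℤ) (hpab : (p : ℤ) = a₀ ^ 2 - a₀ * b₀ + b₀ ^ 2)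
    (ha₀ : a₀ % 3 = 2) (hb₀ : b₀ % 3 = 0) (hb₀pos : 0 < b₀)
    (ω πc : ℂ) (hω : ω = (-1 + Complex.I * Real.sqrt 3) / 2)
    (hπ : πc = (a₀ : ℂ) + (b₀ : ℂ) * ω) :
    ∃ ρ : MulChar F ℂ, orderOf ρ = 3 ∧
      ∑ x : F, ρ x * ρ (1 - x) = (-1 : ℂ) ^ (t + 1) * πc ^ t := by
  have : Fact p.Prime := ⟨hp⟩
  have : CharP F p := charP_of_card_eq_prime_pow hcardF
  obtain ⟨m, hm⟩ : ∃ m, p ^ t = 3 * m + 1 := ⟨p ^ t / 3, by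
    have : p ^ t % 3 = 1 := by simp [Nat.pow_mod, hp3]
    lia⟩
  have hF : Fintype.card F = 3 * m + 1 := hcardF.trans hm
  have hF3 : 3 ∣ Fintype.card F - 1 := ⟨m, by lia⟩
  have hm0 : 0 < m := by
    have := Nat.one_lt_pow (by lia : t ≠ 0) hp.one_lt
    lia
  let w : EisensteinInt := ⟨a₀, b₀⟩
  have hw : w.norm = p := by rw [EisensteinInt.norm_eq, hpab]
  have hw0 : w ≠ 0 := by
    rw [Ne, ← EisensteinInt.norm_eq_zero_iff, hw]
    exact_mod_cast hp.ne_zero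
  have hw3 : (3 : EisensteinInt) ∣ w + 1 := by
    refine ⟨⟨(a₀ + 1) / 3, b₀ / 3⟩, ?_⟩
    ext
    · simp [w, QuadraticAlgebra.re_one, QuadraticAlgebra.re_ofNat, QuadraticAlgebra.im_ofNat]
      lia
    · simp [w, QuadraticAlgebra.im_one, QuadraticAlgebra.re_ofNat, QuadraticAlgebra.im_ofNat]
      lia
  obtain ⟨g, hg, hgw⟩ : ∃ (g : F) (hg : g ^ 2 + g + 1 = 0),
      EisensteinInt.evalAt g hg (star w) = 0 := by
    obtain ⟨g, hg⟩ := FiniteField.exists_sq_add_self_add_one_eq_zero hF3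
    have hmul : EisensteinInt.evalAt g hg w * EisensteinInt.evalAt g hg (star w) = 0 := by
      rw [← map_mul, ← EisensteinInt.natCast_eq_mul_star hw]
      simp
    rcases mul_eq_zero.1 hmul with h | h
    · refine ⟨-1 - g, by linear_combination hg, ?_⟩
      rw [EisensteinInt.evalAt_apply] at h ⊢
      simp only [QuadraticAlgebra.re_star, QuadraticAlgebra.im_star]
      push_cast
      linear_combination h
    · exact ⟨g, hg, h⟩
  obtain ⟨χ, hχ3, hχ1, hχ⟩ := EisensteinInt.exists_mulChar_evalAt_eq_pow hm0 hF hg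
  have hgJ : EisensteinInt.evalAt g hg (jacobiSum χ χ) ≠ 0 := by
    simp only [jacobiSum, map_sum, map_mul, hχ]
    rw [FiniteField.sum_pow_mul_one_sub_pow hm0 hF, neg_ne_zero]
    refine mul_ne_zero (by simp) ?_
    rw [Ne, CharP.cast_eq_zero_iff F p]
    exact not_dvd_choose_two_mul_of_three_mul_add_one hp hp3 t m hm.symm
  have hJ := EisensteinInt.eq_neg_one_pow_mul_pow hg hw hgw hw0 hw3 t (jacobiSum χ χ)
    (by rw [EisensteinInt.norm_jacobiSum hχ3 hχ1, hcardF]; push_cast; rfl) hgJ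
    (EisensteinInt.three_dvd_jacobiSum_add_one hF3 hχ3)
  have hω0 : ω ^ 2 + ω + 1 = 0 := by
    have h3 : (Real.sqrt 3 : ℂ) ^ 2 = 3 := by
      rw [← Complex.ofReal_pow, Real.sq_sqrt (by norm_num)]; norm_num
    rw [hω]
    linear_combination (Complex.I ^ 2 / 4) * h3 + (3 / 4) * Complex.I_sq
  have hinj := EisensteinInt.evalAt_injective ω hω0
  refine ⟨χ.ringHomComp (EisensteinInt.evalAt ω hω0), orderOf_eq_prime ?_ ?_, ?_⟩
  · rw [MulChar.ringHomComp_pow, hχ3, MulChar.ringHomComp_one]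
  · rwa [MulChar.ringHomComp_ne_one_iff hinj]
  · change jacobiSum (χ.ringHomComp _) (χ.ringHomComp _) = _
    rw [jacobiSum_ringHomComp, hJ, map_mul, map_pow, map_pow, map_neg, map_one,
      EisensteinInt.evalAt_apply ω hω0 w, hπ]
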